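/- arXiv:1912.05275 — 5 statements merged into one kernel-verified Lean document; each statement's English description precedes it below -/
import Mathlib

section
/- Let A_c, A_Δ be real n×n matrices with A_Δ having nonnegative entries, and suppose A_c is diagonalizable over ℂ: V⁻¹ A_c V = diag(λ₁,…,λₙ) for an invertible complex matrix V and complex numbers λ₁,…,λₙ. Set r = ‖V‖₂·‖V⁻¹‖₂·‖A_Δ‖₂ and assume the closed discs ⟨λ₁, r⟩, …, ⟨λₙ, r⟩ are pairwise disjoint. Then for every real n×n matrix A with |A_{ij} − (A_c)_{ij}| ≤ (A_Δ)_{ij} for all i, j, and for every index i, the multiset of complex roots of the characteristic polynomial of A (counted with multiplicity) contains exactly one element in the disc ⟨λᵢ, r⟩. -/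
/-- Spectral norm (operator norm induced by the Euclidean norm) of a complex matrix. -/
noncomputable def spectralNormC {n : ℕ} (M : Matrix (Fin n) (Fin n) ℂ) : ℝ :=
  ‖Matrix.toEuclideanCLM (𝕜 := ℂ) M‖

/-- Spectral norm (operator norm induced by the Euclidean norm) of a real matrix. -/
noncomputable def spectralNormR {n : ℕ} (M : Matrix (Fin n) (Fin n) ℝ) : ℝ :=
  ‖Matrix.toEuclideanCLM (𝕜 := ℝ) M‖

theorem Multiset.pow_card_le_prod_map_norm_sub {s : Multiset ℂ} {z : ℂ} {ε : ℝ} (hε : 0 ≤ ε)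
    (h : ∀ a ∈ s, ε ≤ ‖z - a‖) : ε ^ s.card ≤ ‖(s.map fun a => z - a).prod‖ := by
  induction s using Multiset.induction_on with
  | empty => simp
  | cons a s ih =>
    rw [Multiset.card_cons, Multiset.map_cons, Multiset.prod_cons, norm_mul, pow_succ']
    exact mul_le_mul (h a (Multiset.mem_cons_self a s))
      (ih fun b hb => h b (Multiset.mem_cons_of_mem hb)) (pow_nonneg hε _) (norm_nonneg _)

theorem Polynomial.Monic.exists_isRoot_norm_sub_lt {p : Polynomial ℂ} (hp : p.Monic) {z : ℂ}
    {ε : ℝ} (hε : 0 ≤ ε) (h : ‖p.eval z‖ < ε ^ p.natDegree) :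
    ∃ a, p.IsRoot a ∧ ‖z - a‖ < ε := by
  by_contra! hcon
  refine h.not_ge ?_
  have hs := IsAlgClosed.splits p
  rw [hs.eval_eq_prod_roots_of_monic hp, hs.natDegree_eq_card_roots]
  exact Multiset.pow_card_le_prod_map_norm_sub hε fun a ha =>
    hcon a (Polynomial.isRoot_of_mem_roots ha)

/-- If the eigenvalues of a continuous family of matrices stay in the disjoint union of a compact
set and a closed set, then the compact set contains an eigenvalue of either all or none of the
members of the family. -/
theorem Matrix.exists_isRoot_charpoly_mem_of_continuous {T ι : Type*} [TopologicalSpace T]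
    [PreconnectedSpace T] [Fintype ι] [DecidableEq ι] {M : T → Matrix ι ι ℂ} (hM : Continuous M)
    {K C : Set ℂ} (hK : IsCompact K) (hC : IsClosed C) (hKC : Disjoint K C)
    (hroot : ∀ t z, (M t).charpoly.IsRoot z → z ∈ K ∪ C) {t₀ : T}
    (h₀ : ∃ z ∈ K, (M t₀).charpoly.IsRoot z) (t : T) :
    ∃ z ∈ K, (M t).charpoly.IsRoot z := by
  have hcont : Continuous fun x : T × ℂ => (M x.1).charpoly.eval x.2 := by
    simp only [Matrix.eval_charpoly, Matrix.scalar_apply]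
    refine Continuous.matrix_det (.sub (.matrix_diagonal ?_) ?_) <;> fun_prop
  have hclosed : IsClosed {t | ∃ z ∈ K, (M t).charpoly.IsRoot z} := by
    have := isCompact_iff_compactSpace.mp hK
    have h : IsClosed {x : T × K | (M x.1).charpoly.eval (x.2 : ℂ) = 0} :=
      isClosed_eq (hcont.comp (by fun_prop : Continuous fun x : T × K => (x.1, (x.2 : ℂ))))
        continuous_const
    convert isClosedMap_fst_of_compactSpace _ h using 1
    ext t
    simp [Polynomial.IsRoot]
  have hopen : IsOpen {t | ∃ z ∈ K, (M t).charpoly.IsRoot z} := by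
    rw [isOpen_iff_mem_nhds]
    rintro s ⟨z, hzK, hz⟩
    obtain ⟨ε, hε, hball⟩ := Metric.isOpen_iff.mp hC.isOpen_compl z
      (Set.disjoint_left.mp hKC hzK)
    have hs : Continuous fun t => ‖(M t).charpoly.eval z‖ :=
      (hcont.comp (by fun_prop : Continuous fun t : T => (t, z))).norm
    have hlt : ‖(M s).charpoly.eval z‖ < ε ^ Fintype.card ι := by
      rw [hz.eq_zero, norm_zero]
      positivity
    filter_upwards [hs.continuousAt.eventually_lt continuousAt_const hlt] with t ht
    obtain ⟨a, ha, haz⟩ := (M t).charpoly_monic.exists_isRoot_norm_sub_lt hε.le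
      (by rwa [Matrix.charpoly_natDegree_eq_dim])
    refine ⟨a, (hroot t a ha).resolve_right (hball ?_), ha⟩
    rwa [Metric.mem_ball, dist_comm, dist_eq_norm]
  have huniv := IsClopen.eq_univ ⟨hclosed, hopen⟩ ⟨t₀, h₀⟩
  exact huniv.ge (Set.mem_univ t)

/-- An eigenvalue of the perturbation of a diagonal matrix by `E` lies within `‖E‖₂` of some
diagonal entry. -/
theorem exists_norm_sub_le_of_isRoot_charpoly_diagonal_add {n : ℕ} {lam : Fin n → ℂ}
    {E : Matrix (Fin n) (Fin n) ℂ} {r : ℝ} (hE : spectralNormC E ≤ r) {z : ℂ}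
    (hz : (Matrix.diagonal lam + E).charpoly.IsRoot z) : ∃ j, ‖z - lam j‖ ≤ r := by
  by_contra! hcon
  have hr : 0 ≤ r := (norm_nonneg _).trans hE
  rw [Polynomial.IsRoot, Matrix.eval_charpoly] at hz
  obtain ⟨v, hv, hvz⟩ := Matrix.exists_mulVec_eq_zero_iff.mpr hz
  have hEv : ∀ j, (E.mulVec v) j = (z - lam j) * v j := fun j => by
    have := congrFun hvz j
    simp only [Matrix.sub_mulVec, Matrix.add_mulVec, Matrix.scalar_apply,
      Matrix.mulVec_diagonal, Pi.sub_apply, Pi.add_apply, Pi.zero_apply] at this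
    linear_combination -this
  have hle : ‖WithLp.toLp 2 (E.mulVec v)‖ ≤ r * ‖WithLp.toLp 2 v‖ :=
    ((Matrix.toEuclideanCLM (𝕜 := ℂ) E).le_opNorm (WithLp.toLp 2 v)).trans (by gcongr; exact hE)
  have hsq := pow_le_pow_left₀ (norm_nonneg _) hle 2
  rw [mul_pow, EuclideanSpace.norm_sq_eq, EuclideanSpace.norm_sq_eq, Finset.mul_sum] at hsq
  refine hsq.not_gt ?_
  simp only [hEv, norm_mul, mul_pow]
  obtain ⟨k, hk⟩ := Function.ne_iff.mp hv
  refine Finset.sum_lt_sum (fun j _ => ?_) ⟨k, Finset.mem_univ k, ?_⟩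
  · gcongr
    exact (hcon j).le
  · have : 0 < ‖v k‖ := norm_pos_iff.mpr hk
    gcongr
    exact hcon k

theorem spectralNormC_mul_le {n : ℕ} (M N : Matrix (Fin n) (Fin n) ℂ) :
    spectralNormC (M * N) ≤ spectralNormC M * spectralNormC N := by
  simp only [spectralNormC, map_mul]
  exact norm_mul_le _ _

theorem spectralNormC_le_of_norm_le {n : ℕ} {B : Matrix (Fin n) (Fin n) ℂ}
    {D : Matrix (Fin n) (Fin n) ℝ} (h : ∀ i j, ‖B i j‖ ≤ D i j) :
    spectralNormC B ≤ spectralNormR D := by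
  refine ContinuousLinearMap.opNorm_le_bound _ (norm_nonneg _) fun x => ?_
  have hle := (Matrix.toEuclideanCLM (𝕜 := ℝ) D).le_opNorm (WithLp.toLp 2 fun j => ‖x j‖)
  have hx : ‖WithLp.toLp 2 fun j => ‖x j‖‖ = ‖x‖ := by simp [EuclideanSpace.norm_eq]
  rw [hx] at hle
  refine le_trans ?_ hle
  rw [EuclideanSpace.norm_eq, EuclideanSpace.norm_eq]
  refine Real.sqrt_le_sqrt (Finset.sum_le_sum fun i _ => ?_)
  refine pow_le_pow_left₀ (norm_nonneg _) ?_ 2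
  refine le_trans ?_ (le_abs_self _)
  rw [Matrix.ofLp_toEuclideanCLM, Matrix.ofLp_toEuclideanCLM]
  simp only [Matrix.mulVec, dotProduct]
  refine (norm_sum_le _ _).trans (Finset.sum_le_sum fun j _ => ?_)
  rw [norm_mul]
  exact mul_le_mul_of_nonneg_right (h i j) (norm_nonneg _)

open scoped Classical in
theorem Multiset.sum_card_filter_le_card {α ι : Type*} [Fintype ι] {D : ι → Set α}
    (hD : _root_.Pairwise fun i j => Disjoint (D i) (D j)) (s : Multiset α) :
    ∑ i, (s.filter fun z => z ∈ D i).card ≤ s.card := by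
  induction s using Multiset.induction_on with
  | empty => simp
  | cons a s ih =>
    have hone : ∑ i, (if a ∈ D i then 1 else 0) ≤ 1 := by
      rw [← Finset.card_filter, Finset.card_le_one]
      intro i hi j hj
      by_contra hij
      exact Set.disjoint_left.mp (hD hij) (Finset.mem_filter.mp hi).2 (Finset.mem_filter.mp hj).2
    simp only [← Multiset.countP_eq_card_filter, Multiset.countP_cons, Finset.sum_add_distrib,
      Multiset.card_cons] at ih ⊢
    exact add_le_add ih hone

open scoped Classical in
theorem Multiset.card_filter_eq_one {α ι : Type*} [Fintype ι] {D : ι → Set α}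
    (hD : _root_.Pairwise fun i j => Disjoint (D i) (D j)) {s : Multiset α}
    (hs : s.card = Fintype.card ι) (h : ∀ i, ∃ z ∈ s, z ∈ D i) (i : ι) :
    (s.filter fun z => z ∈ D i).card = 1 := by
  have hpos : ∀ i ∈ Finset.univ, 1 ≤ (s.filter fun z => z ∈ D i).card := fun i _ => by
    obtain ⟨z, hz, hzD⟩ := h i
    exact Multiset.card_pos_iff_exists_mem.mpr ⟨z, Multiset.mem_filter.mpr ⟨hz, hzD⟩⟩
  have hsum : ∑ _i : ι, 1 = ∑ i, (s.filter fun z => z ∈ D i).card :=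
    (Finset.sum_le_sum hpos).antisymm
      ((Multiset.sum_card_filter_le_card hD s).trans (by simp [hs]))
  exact ((Finset.sum_eq_sum_iff_of_le hpos).mp hsum i (Finset.mem_univ i)).symm

open scoped Classical in
/-- If the Bauer–Fike discs are pairwise disjoint, then each disc `⟨λᵢ, r⟩` contains exactly
one eigenvalue (counted with multiplicity) of every member of the interval matrix. -/
theorem exactly_one_eigenvalue_in_each_disc {n : ℕ}
    (Ac AΔ : Matrix (Fin n) (Fin n) ℝ) (hΔ : ∀ i j, 0 ≤ AΔ i j)
    (V : Matrix (Fin n) (Fin n) ℂ) (lam : Fin n → ℂ)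
    (hV : IsUnit V.det)
    (hdiag : V⁻¹ * Ac.map (Complex.ofReal) * V = Matrix.diagonal lam)
    (r : ℝ) (hr : r = spectralNormC V * spectralNormC V⁻¹ * spectralNormR AΔ)
    (hdisj : Pairwise fun i j : Fin n =>
      Disjoint (Metric.closedBall (lam i) r) (Metric.closedBall (lam j) r)) :
    ∀ A : Matrix (Fin n) (Fin n) ℝ, (∀ i j, |A i j - Ac i j| ≤ AΔ i j) →
      ∀ i : Fin n,
        (((A.map (Complex.ofReal)).charpoly.roots).filter
          (fun z => z ∈ Metric.closedBall (lam i) r)).card = 1 := by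
  intro A hA i
  refine Multiset.card_filter_eq_one (D := fun j => Metric.closedBall (lam j) r) hdisj ?_
    (fun j => ?_) i
  · rw [← (IsAlgClosed.splits _).natDegree_eq_card_roots, Matrix.charpoly_natDegree_eq_dim]
  have hV' : IsUnit V := (Matrix.isUnit_iff_isUnit_det V).mpr hV
  set B : Matrix (Fin n) (Fin n) ℂ := A.map Complex.ofReal - Ac.map Complex.ofReal with hB
  set E := V⁻¹ * B * V with hE
  have hEr : spectralNormC E ≤ r := by
    have hBΔ : spectralNormC B ≤ spectralNormR AΔ := by
      refine spectralNormC_le_of_norm_le fun k l => ?_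
      rw [hB, Matrix.sub_apply, Matrix.map_apply, Matrix.map_apply, ← Complex.ofReal_sub,
        Complex.norm_real]
      exact hA k l
    calc spectralNormC E ≤ spectralNormC V⁻¹ * spectralNormC B * spectralNormC V :=
          (spectralNormC_mul_le _ _).trans
            (mul_le_mul_of_nonneg_right (spectralNormC_mul_le _ _) (norm_nonneg _))
      _ ≤ spectralNormC V⁻¹ * spectralNormR AΔ * spectralNormC V :=
          mul_le_mul_of_nonneg_right (mul_le_mul_of_nonneg_left hBΔ (norm_nonneg _))
            (norm_nonneg _)
      _ = r := by rw [hr]; ring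
  have htE : ∀ t : unitInterval, spectralNormC (((t : ℝ) : ℂ) • E) ≤ r := fun t => by
    refine le_trans ?_ hEr
    rw [spectralNormC, map_smul, norm_smul, Complex.norm_real, Real.norm_of_nonneg t.2.1]
    exact mul_le_of_le_one_left (norm_nonneg _) t.2.2
  have hconj : Matrix.diagonal lam + E = V⁻¹ * A.map Complex.ofReal * V := by
    rw [← hdiag, hE, hB, Matrix.mul_sub, Matrix.sub_mul]
    abel
  obtain ⟨z, hzK, hz⟩ := Matrix.exists_isRoot_charpoly_mem_of_continuous
    (M := fun t : unitInterval => Matrix.diagonal lam + ((t : ℝ) : ℂ) • E) (by fun_prop)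
    (isCompact_closedBall (lam j) r)
    (C := ⋃ k : {k // k ≠ j}, Metric.closedBall (lam k) r)
    (isClosed_iUnion_of_finite fun _ => Metric.isClosed_closedBall)
    (Set.disjoint_iUnion_right.mpr fun k => hdisj k.2.symm)
    (fun t z hz => by
      obtain ⟨k, hk⟩ := exists_norm_sub_le_of_isRoot_charpoly_diagonal_add (htE t) hz
      rw [← dist_eq_norm] at hk
      by_cases hkj : k = j
      · exact Or.inl (hkj ▸ hk)
      · exact Or.inr (Set.mem_iUnion.mpr ⟨⟨k, hkj⟩, hk⟩))
    (t₀ := 0)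
    ⟨lam j, Metric.mem_closedBall_self ((norm_nonneg _).trans hEr), by
      simp [Matrix.charpoly_diagonal, Polynomial.IsRoot, Polynomial.eval_prod,
        Finset.prod_eq_zero_iff, sub_eq_zero]⟩ 1
  refine ⟨z, (Polynomial.mem_roots (Matrix.charpoly_monic _).ne_zero).mpr ?_, hzK⟩
  have hchar : (V⁻¹ * A.map Complex.ofReal * V).charpoly = (A.map Complex.ofReal).charpoly := by
    obtain ⟨U, rfl⟩ := hV'
    simp
  simpa [hconj, hchar] using hz
end

section
/- Let A_c, A_Δ be real n×n matrices with A_Δ having nonnegative entries, and suppose A_c is diagonalizable over ℂ: V⁻¹ A_c V = diag(λ₁,…,λₙ) for an invertible complex matrix V and complex numbers λ₁,…,λₙ. Set r = ‖V‖₂·‖V⁻¹‖₂·‖A_Δ‖₂ and assume the closed discs ⟨λ₁, r⟩, …, ⟨λₙ, r⟩ are pairwise disjoint. Then for every real n×n matrix A with |A_{ij} − (A_c)_{ij}| ≤ (A_Δ)_{ij} for all i, j, every complex eigenvalue of A is simple, i.e., is a root of the characteristic polynomial of A of multiplicity exactly 1. -/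
/-- A root of multiplicity at least two of the characteristic polynomial has a right and a left
eigenvector that annihilate each other. -/
theorem Matrix.exists_eigenvectors_dotProduct_eq_zero {K n : Type*} [Field K] [Fintype n]
    [DecidableEq n] (M : Matrix n n K) (μ : K) (h : 1 < M.charpoly.rootMultiplicity μ) :
    ∃ x y : n → K, x ≠ 0 ∧ y ≠ 0 ∧ M.mulVec x = μ • x ∧ Matrix.vecMul y M = μ • y ∧
      dotProduct y x = 0 := by
  have hroot : M.charpoly.IsRoot μ :=
    ((Polynomial.rootMultiplicity_pos' (p := M.charpoly)).1 (by omega)).2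
  have hdet : (Matrix.scalar n μ - M).det = 0 := by
    rw [← Matrix.eval_charpoly]; exact hroot
  obtain ⟨y, hy0, hy⟩ := Matrix.exists_vecMul_eq_zero_iff.2 hdet
  have hyM : Matrix.vecMul y M = μ • y := by
    rw [Matrix.vecMul_sub, sub_eq_zero] at hy
    rw [← hy]
    ext i
    simp [Matrix.vecMul_diagonal, mul_comm]
  set f : Module.End K (n → K) := Matrix.toLin' M with hf
  set N : Module.End K (n → K) := f - μ • 1 with hN
  have hNy (v : n → K) : dotProduct y (N v) = 0 := by
    simp [hN, hf, dotProduct_sub, Matrix.dotProduct_mulVec, hyM]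
  let G := f.maxGenEigenspace μ
  have hG : 1 < Module.finrank K G := by
    rw [LinearMap.finrank_maxGenEigenspace_eq, hf, Matrix.charpoly_toLin']
    exact h
  let φ : G →ₗ[K] K := (dotProductBilin K K y).comp G.subtype
  have hker : LinearMap.ker φ ≠ ⊥ :=
    φ.ker_ne_bot_of_finrank_lt (by simpa using hG)
  obtain ⟨g, hg, hg0⟩ := Submodule.exists_mem_ne_zero_of_ne_bot hker
  have hyg : dotProduct y (g : n → K) = 0 := by simpa [φ] using hg
  have hex : ∃ k : ℕ, (N ^ k) (g : n → K) = 0 := (f.mem_maxGenEigenspace μ g).1 g.2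
  classical
  obtain ⟨k, hk, hmin⟩ : ∃ k : ℕ, (N ^ k) (g : n → K) = 0 ∧
      ∀ m < k, (N ^ m) (g : n → K) ≠ 0 :=
    ⟨Nat.find hex, Nat.find_spec hex, fun m hm => Nat.find_min hex hm⟩
  cases k with
  | zero => exact absurd (by simpa using hk) hg0
  | succ k =>
    refine ⟨(N ^ k) g, y, hmin k (Nat.lt_succ_self k), hy0, ?_, hyM, ?_⟩
    · rw [pow_succ', Module.End.mul_apply] at hk
      have : f ((N ^ k) g) - μ • (N ^ k) g = 0 := by simpa [hN] using hk
      simpa [hf] using sub_eq_zero.1 this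
    · cases k with
      | zero => simpa using hyg
      | succ k => rw [pow_succ', Module.End.mul_apply]; exact hNy _

/-- A coordinate vector with small weighted norm is dominated by the coordinate whose weight is
isolated from all others. -/
theorem sum_erase_norm_sq_lt {n : Type*} [Fintype n] [DecidableEq n] {lam x : n → ℂ} {μ : ℂ}
    {r : ℝ} {i : n} (hi : dist (lam i) μ ≤ r) (hsep : ∀ j, j ≠ i → 2 * r < dist (lam j) (lam i))
    (hx : x ≠ 0) (h : ∑ j, dist (lam j) μ ^ 2 * ‖x j‖ ^ 2 ≤ r ^ 2 * ∑ j, ‖x j‖ ^ 2) :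
    ∑ j ∈ Finset.univ.erase i, ‖x j‖ ^ 2 < ‖x i‖ ^ 2 := by
  set d := dist (lam i) μ with hd
  have hd0 : 0 ≤ d := dist_nonneg
  by_contra! hle
  have hfar (j : n) (hj : j ≠ i) : 2 * r - d < dist (lam j) μ := by
    linarith [hsep j hj, dist_triangle_right (lam j) (lam i) μ]
  have hpos : ∃ j, j ≠ i ∧ x j ≠ 0 := by
    by_contra! hz
    have hs : ∑ j ∈ Finset.univ.erase i, ‖x j‖ ^ 2 = 0 :=
      Finset.sum_eq_zero fun j hj => by simp [hz j (Finset.ne_of_mem_erase hj)]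
    have hxi : x i = 0 := by
      rw [hs] at hle
      simpa using le_antisymm hle (by positivity)
    exact hx (funext fun j => if hj : j = i then hj ▸ hxi else hz j hj)
  obtain ⟨k, hki, hk⟩ := hpos
  have hlt : (2 * r - d) ^ 2 * ∑ j ∈ Finset.univ.erase i, ‖x j‖ ^ 2 <
      ∑ j ∈ Finset.univ.erase i, dist (lam j) μ ^ 2 * ‖x j‖ ^ 2 := by
    rw [Finset.mul_sum]
    refine Finset.sum_lt_sum (fun j hj => ?_) ⟨k, by simp [hki], ?_⟩
    · have := hfar j (Finset.ne_of_mem_erase hj)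
      have : 0 ≤ 2 * r - d := by linarith
      gcongr
    · have := hfar k hki
      have : 0 ≤ 2 * r - d := by linarith
      have : 0 < ‖x k‖ := norm_pos_iff.2 hk
      gcongr
  rw [← Finset.add_sum_erase _ _ (Finset.mem_univ i),
    ← Finset.add_sum_erase _ _ (Finset.mem_univ i), ← hd] at h
  set S := ∑ j ∈ Finset.univ.erase i, ‖x j‖ ^ 2
  nlinarith [mul_nonneg (sub_nonneg.2 hle)
      (mul_nonneg (sub_nonneg.2 hi) (add_nonneg hd0 (hd0.trans hi))),
    mul_nonneg (sq_nonneg (r - d)) (le_trans (sq_nonneg _) hle)]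

/-- Two vectors concentrated on the same coordinate are not annihilated by each other. -/
theorem dotProduct_ne_zero_of_sum_erase_lt {n : Type*} [Fintype n] [DecidableEq n]
    {x y : n → ℂ} {i : n} (hx : ∑ j ∈ Finset.univ.erase i, ‖x j‖ ^ 2 < ‖x i‖ ^ 2)
    (hy : ∑ j ∈ Finset.univ.erase i, ‖y j‖ ^ 2 < ‖y i‖ ^ 2) : dotProduct y x ≠ 0 := by
  intro h
  rw [dotProduct, ← Finset.add_sum_erase _ _ (Finset.mem_univ i), add_eq_zero_iff_eq_neg] at h
  have hle : ‖y i‖ * ‖x i‖ ≤ ∑ j ∈ Finset.univ.erase i, ‖y j‖ * ‖x j‖ := by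
    rw [← norm_mul, h, norm_neg]
    exact (norm_sum_le _ _).trans_eq (by simp)
  have hcs := Finset.sum_mul_sq_le_sq_mul_sq (Finset.univ.erase i) (fun j => ‖y j‖)
    (fun j => ‖x j‖)
  have hlt := mul_lt_mul'' hy hx (Finset.sum_nonneg fun j _ => sq_nonneg _)
    (Finset.sum_nonneg fun j _ => sq_nonneg _)
  have hsq := pow_le_pow_left₀ (by positivity) hle 2
  rw [mul_pow] at hsq
  linarith

open scoped Matrix.Norms.L2Operator in
/-- Residual bound for an eigenvector of a perturbed diagonal matrix. -/
theorem sum_dist_sq_mul_norm_sq_le {n : Type*} [Fintype n] [DecidableEq n] {lam x : n → ℂ}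
    {μ : ℂ} {E : Matrix n n ℂ} {r : ℝ} (hE : ‖E‖ ≤ r)
    (h : (Matrix.diagonal lam + E).mulVec x = μ • x) :
    ∑ j, dist (lam j) μ ^ 2 * ‖x j‖ ^ 2 ≤ r ^ 2 * ∑ j, ‖x j‖ ^ 2 := by
  have hb := (E.l2_opNorm_mulVec (WithLp.toLp 2 x)).trans
    (mul_le_mul_of_nonneg_right hE (norm_nonneg _))
  have hsq := pow_le_pow_left₀ (norm_nonneg _) hb 2
  rw [mul_pow, EuclideanSpace.norm_sq_eq, EuclideanSpace.norm_sq_eq] at hsq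
  refine le_trans (Finset.sum_le_sum fun j _ => ?_) hsq
  have hj := congrFun h j
  rw [Matrix.add_mulVec, Pi.add_apply, Matrix.mulVec_diagonal, Pi.smul_apply, smul_eq_mul] at hj
  have : (E.mulVec x) j = -((lam j - μ) * x j) := by linear_combination hj
  refine le_of_eq ?_
  change _ = ‖(E.mulVec x) j‖ ^ 2
  rw [this, norm_neg, norm_mul, mul_pow, dist_eq_norm]

open scoped Matrix.Norms.L2Operator in
/-- Entrywise domination implies domination of spectral norms. -/
theorem l2_opNorm_le_of_norm_entry_le {m n : Type*} [Fintype m] [Fintype n] [DecidableEq n]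
    {F : Matrix m n ℂ} {B : Matrix m n ℝ} (h : ∀ i j, ‖F i j‖ ≤ B i j) : ‖F‖ ≤ ‖B‖ := by
  rw [Matrix.l2_opNorm_def]
  refine ContinuousLinearMap.opNorm_le_bound _ (norm_nonneg _) fun x => ?_
  have hb := B.l2_opNorm_mulVec (WithLp.toLp 2 fun j => ‖x j‖)
  have hx : ‖(WithLp.toLp 2 fun j => ‖x j‖ : EuclideanSpace ℝ n)‖ = ‖x‖ := by
    simp [EuclideanSpace.norm_eq]
  rw [hx] at hb
  refine le_trans ?_ hb
  rw [EuclideanSpace.norm_eq, EuclideanSpace.norm_eq]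
  refine Real.sqrt_le_sqrt (Finset.sum_le_sum fun i _ => ?_)
  refine pow_le_pow_left₀ (norm_nonneg _) ?_ 2
  change ‖∑ j, F i j * x j‖ ≤ ‖∑ j, B i j * ‖x j‖‖
  refine le_trans ?_ (le_abs_self _)
  refine (norm_sum_le _ _).trans (Finset.sum_le_sum fun j _ => ?_)
  rw [norm_mul]
  exact mul_le_mul_of_nonneg_right (h i j) (norm_nonneg _)

open scoped Matrix.Norms.L2Operator in
/-- A perturbation of a diagonal matrix whose size is less than half of the separation of the
diagonal entries has only simple eigenvalues. -/
theorem rootMultiplicity_charpoly_diagonal_add_le_one {n : Type*} [Fintype n] [DecidableEq n]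
    {lam : n → ℂ} {E : Matrix n n ℂ} {r : ℝ} (hE : ‖E‖ ≤ r)
    (hsep : ∀ i j, i ≠ j → 2 * r < dist (lam i) (lam j)) (μ : ℂ) :
    (Matrix.diagonal lam + E).charpoly.rootMultiplicity μ ≤ 1 := by
  by_contra! hμ
  obtain ⟨x, y, hx0, hy0, hx, hy, hyx⟩ := Matrix.exists_eigenvectors_dotProduct_eq_zero _ μ hμ
  have hr : 0 ≤ r := (norm_nonneg E).trans hE
  have hbx := sum_dist_sq_mul_norm_sq_le hE hx
  have hstar : (Matrix.diagonal (star lam) + E.conjTranspose).mulVec (star y) =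
      star μ • star y := by
    rw [← Matrix.diagonal_conjTranspose, ← Matrix.conjTranspose_add, ← Matrix.star_vecMul, hy,
      star_smul]
  have hby : ∑ j, dist (lam j) μ ^ 2 * ‖y j‖ ^ 2 ≤ r ^ 2 * ∑ j, ‖y j‖ ^ 2 := by
    have := sum_dist_sq_mul_norm_sq_le (E.l2_opNorm_conjTranspose.trans_le hE) hstar
    simpa [dist_eq_norm, ← map_sub] using this
  obtain ⟨i, hi⟩ : ∃ i, dist (lam i) μ ≤ r := by
    by_contra! hfar
    obtain ⟨k, hk⟩ := Function.ne_iff.1 hx0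
    refine hbx.not_gt ?_
    rw [Finset.mul_sum]
    refine Finset.sum_lt_sum (fun j _ => ?_) ⟨k, Finset.mem_univ k, ?_⟩
    · have := hfar j
      gcongr
    · have := hfar k
      have : 0 < ‖x k‖ := norm_pos_iff.2 hk
      gcongr
  exact dotProduct_ne_zero_of_sum_erase_lt
    (sum_erase_norm_sq_lt hi (fun j hj => hsep j i hj) hx0 hbx)
    (sum_erase_norm_sq_lt hi (fun j hj => hsep j i hj) hy0 hby) hyx


/-- If the Bauer–Fike discs are pairwise disjoint, then every eigenvalue of every member of
the interval matrix is simple. -/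
theorem eigenvalues_simple_of_disjoint_discs {n : ℕ}
    (Ac AΔ : Matrix (Fin n) (Fin n) ℝ) (hΔ : ∀ i j, 0 ≤ AΔ i j)
    (V : Matrix (Fin n) (Fin n) ℂ) (lam : Fin n → ℂ)
    (hV : IsUnit V.det)
    (hdiag : V⁻¹ * Ac.map (Complex.ofReal) * V = Matrix.diagonal lam)
    (r : ℝ) (hr : r = spectralNormC V * spectralNormC V⁻¹ * spectralNormR AΔ)
    (hdisj : Pairwise fun i j : Fin n =>
      Disjoint (Metric.closedBall (lam i) r) (Metric.closedBall (lam j) r)) :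
    ∀ A : Matrix (Fin n) (Fin n) ℝ, (∀ i j, |A i j - Ac i j| ≤ AΔ i j) →
      ∀ μ : ℂ, ((A.map (Complex.ofReal)).charpoly).IsRoot μ →
        ((A.map (Complex.ofReal)).charpoly).rootMultiplicity μ = 1 := by
  intro A hA μ hμ
  let F : Matrix (Fin n) (Fin n) ℂ := A.map Complex.ofReal - Ac.map Complex.ofReal
  have hF : spectralNormC F ≤ spectralNormR AΔ :=
    l2_opNorm_le_of_norm_entry_le fun i j => by
      change ‖(A i j : ℂ) - (Ac i j : ℂ)‖ ≤ AΔ i j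
      rw [← Complex.ofReal_sub, Complex.norm_real]
      exact hA i j
  have hE : spectralNormC (V⁻¹ * F * V) ≤ r := by
    calc spectralNormC (V⁻¹ * F * V)
        ≤ spectralNormC V⁻¹ * spectralNormC F * spectralNormC V :=
          (spectralNormC_mul_le _ _).trans
            (mul_le_mul_of_nonneg_right (spectralNormC_mul_le _ _) (norm_nonneg _))
      _ ≤ spectralNormC V⁻¹ * spectralNormR AΔ * spectralNormC V :=
          mul_le_mul_of_nonneg_right (mul_le_mul_of_nonneg_left hF (norm_nonneg _))
            (norm_nonneg _)
      _ = r := by rw [hr]; ring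
  have hr0 : 0 ≤ r := (norm_nonneg _).trans hE
  have hsep (i j : Fin n) (hij : i ≠ j) : 2 * r < dist (lam i) (lam j) := by
    have := (disjoint_closedBall_closedBall_iff hr0 hr0).1 (hdisj hij)
    linarith
  have hconj : Matrix.diagonal lam + V⁻¹ * F * V = V⁻¹ * A.map Complex.ofReal * V := by
    rw [← hdiag, ← add_mul, ← mul_add, add_sub_cancel]
  have hchar : (A.map Complex.ofReal).charpoly =
      (Matrix.diagonal lam + V⁻¹ * F * V).charpoly := by
    rw [hconj, Matrix.charpoly_mul_comm, ← mul_assoc, Matrix.mul_nonsing_inv V hV, one_mul]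
  refine le_antisymm ?_ ?_
  · rw [hchar]
    exact rootMultiplicity_charpoly_diagonal_add_le_one hE hsep μ
  · exact (Polynomial.rootMultiplicity_pos (Matrix.charpoly_monic _).ne_zero).2 hμ
end

section
/- Let A be a complex n×n matrix and let λ ∈ ℂ be a simple eigenvalue of A (a root of the characteristic polynomial of A with multiplicity exactly 1). Set B = A − λ·I. Then there exist indices i, j such that the (n−1)×(n−1) matrix B^{ij} obtained from B by deleting row i and column j is nonsingular, and the vector x ∈ ℂⁿ obtained by inserting the value 1 at position j into the unique solution x̃ of B^{ij} x̃ = −B^{i}_{*j} is an eigenvector of A corresponding to λ, i.e., x ≠ 0 and Ax = λx. -/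
namespace Matrix

open Polynomial

/-- At a simple root of the characteristic polynomial the adjugate of the characteristic matrix
does not vanish. -/
theorem adjugate_scalar_sub_ne_zero_of_rootMultiplicity_eq_one {K m : Type*} [Field K] [Fintype m]
    [DecidableEq m] [Nonempty m] (A : Matrix m m K) (μ : K)
    (h : A.charpoly.rootMultiplicity μ = 1) : (scalar m μ - A).adjugate ≠ 0 := by
  classical
  intro h0
  have hmap : (charmatrix A).adjugate.map (evalRingHom μ) = (scalar m μ - A).adjugate := by
    have := (evalRingHom μ).map_adjugate (charmatrix A)
    rw [RingHom.mapMatrix_apply, RingHom.mapMatrix_apply] at this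
    rw [this]
    congr 1
    ext i j
    by_cases hij : i = j <;> simp [hij]
  have hdvd : ∀ i j, (X - C μ) ∣ (charmatrix A).adjugate i j := fun i j => by
    rw [dvd_iff_isRoot]
    rw [h0] at hmap
    simpa using congrFun (congrFun hmap i) j
  choose Q hQ using hdvd
  have hadj : (charmatrix A).adjugate = (X - C μ) • of Q := by
    ext1 i j
    simp [hQ i j]
  have hdet : A.charpoly ^ (Fintype.card m - 1) = (X - C μ) ^ Fintype.card m * (of Q).det := by
    rw [charpoly, ← det_adjugate, hadj, det_smul]
  have hne : A.charpoly ^ (Fintype.card m - 1) ≠ 0 := pow_ne_zero _ A.charpoly_monic.ne_zero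
  have hle := (le_rootMultiplicity_iff hne).2 (Dvd.intro _ hdet.symm)
  rw [← count_roots, roots_pow, Multiset.count_nsmul, count_roots, h] at hle
  have := Fintype.card_pos (α := m)
  omega

/-- If `M` is singular and its minor at `(i, j)` is not, then a vector killed by all rows of `M`
other than the `i`-th is killed by `M`. -/
theorem mulVec_eq_zero_of_det_submatrix_ne_zero {R : Type*} [CommRing R] [IsDomain R] {n : ℕ}
    (M : Matrix (Fin (n + 1)) (Fin (n + 1)) R) (hM : M.det = 0) {i j : Fin (n + 1)}
    (hij : (M.submatrix i.succAbove j.succAbove).det ≠ 0) {x : Fin (n + 1) → R}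
    (hx : ∀ k, (M *ᵥ x) (i.succAbove k) = 0) : M *ᵥ x = 0 := by
  have hadj : M.adjugate j i * (M *ᵥ x) i = 0 := by
    have h : (M.adjugate *ᵥ (M *ᵥ x)) j = 0 := by
      rw [mulVec_mulVec, adjugate_mul, hM]
      simp
    rw [mulVec, dotProduct, Fin.sum_univ_succAbove _ i] at h
    simpa [hx] using h
  have hne : M.adjugate j i ≠ 0 := by
    rw [adjugate_fin_succ_eq_det_submatrix]
    exact mul_ne_zero (pow_ne_zero _ (neg_ne_zero.2 one_ne_zero)) hij
  funext k
  rcases Fin.eq_self_or_eq_succAbove i k with rfl | ⟨k, rfl⟩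
  · exact (mul_eq_zero.1 hadj).resolve_left hne
  · exact hx k

end Matrix


/-- For a simple eigenvalue `μ` of `A`, with `B = A - μ·I`, there are indices `i, j` such that
the minor `B^{ij}` is nonsingular and the vector obtained from the unique solution of
`B^{ij} x̃ = -B^{i}_{*j}` by inserting `1` at position `j` is an eigenvector of `A` for `μ`. -/
theorem eigenvector_from_minor_solution {n : ℕ}
    (A : Matrix (Fin (n + 1)) (Fin (n + 1)) ℂ) (μ : ℂ)
    (hsimple : A.charpoly.rootMultiplicity μ = 1) :
    ∃ i j : Fin (n + 1),
      ((A - μ • (1 : Matrix (Fin (n + 1)) (Fin (n + 1)) ℂ)).submatrix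
          i.succAbove j.succAbove).det ≠ 0 ∧
      ∀ (xt : Fin n → ℂ) (x : Fin (n + 1) → ℂ),
        ((A - μ • (1 : Matrix (Fin (n + 1)) (Fin (n + 1)) ℂ)).submatrix
            i.succAbove j.succAbove).mulVec xt =
          (- fun k : Fin n => (A - μ • (1 : Matrix (Fin (n + 1)) (Fin (n + 1)) ℂ))
            (i.succAbove k) j) →
        x j = 1 → (∀ k : Fin n, x (j.succAbove k) = xt k) →
        x ≠ 0 ∧ A.mulVec x = μ • x := by
  set B := A - μ • (1 : Matrix (Fin (n + 1)) (Fin (n + 1)) ℂ) with hB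
  have hneg : Matrix.scalar (Fin (n + 1)) μ - A = -B := by
    rw [hB, neg_sub, Matrix.scalar_apply, Matrix.smul_one_eq_diagonal]
  have hdet : B.det = 0 := by
    have hroot : A.charpoly.IsRoot μ :=
      (Polynomial.rootMultiplicity_pos A.charpoly_monic.ne_zero).1 (by omega)
    rw [Polynomial.IsRoot, Matrix.eval_charpoly, hneg, Matrix.det_neg] at hroot
    simpa using hroot
  obtain ⟨i, j, hij⟩ : ∃ i j : Fin (n + 1),
      (B.submatrix i.succAbove j.succAbove).det ≠ 0 := by
    by_contra! h
    apply Matrix.adjugate_scalar_sub_ne_zero_of_rootMultiplicity_eq_one A μ hsimple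
    rw [hneg, ← neg_one_smul ℂ B, Matrix.adjugate_smul]
    ext i j
    simp [Matrix.adjugate_fin_succ_eq_det_submatrix, h]
  refine ⟨i, j, hij, fun xt x hxt hxj hx => ⟨fun h => by simp [h] at hxj, ?_⟩⟩
  have hBx : B.mulVec x = 0 := by
    refine Matrix.mulVec_eq_zero_of_det_submatrix_ne_zero B hdet hij fun k => ?_
    have hk := congrFun hxt k
    simp only [Matrix.mulVec, dotProduct, Matrix.submatrix_apply, Pi.neg_apply] at hk
    rw [Matrix.mulVec, dotProduct, Fin.sum_univ_succAbove _ j]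
    simp [hxj, hx, hk]
  rwa [hB, Matrix.sub_mulVec, Matrix.smul_mulVec, Matrix.one_mulVec, sub_eq_zero] at hBx
end

section
/- Let C be a real n×n matrix and x ∈ ℝⁿ, and let A be the (n+1)×(n+1) block matrix A = [[C, x],[xᵀ, 0]] (C in the top-left n×n block, x as the last column's first n entries, xᵀ as the last row's first n entries, and 0 in the bottom-right corner). Then the bottom-right entry of A³ equals the quadratic form xᵀ C x, i.e., (A³)_{n+1,n+1} = Σ_{i,j} x_i C_{ij} x_j. -/
/-- The bottom-right entry of the cube of the block matrix `[[C, x], [xᵀ, 0]]`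
is the quadratic form `xᵀ C x`. -/
theorem cube_corner_entry_of_bordered_matrix {n : ℕ}
    (C : Matrix (Fin n) (Fin n) ℝ) (x : Fin n → ℝ)
    (A : Matrix (Fin n ⊕ Unit) (Fin n ⊕ Unit) ℝ)
    (hA : A = Matrix.fromBlocks C
      (Matrix.of fun i (_ : Unit) => x i)
      (Matrix.of fun (_ : Unit) j => x j)
      (0 : Matrix Unit Unit ℝ)) :
    (A ^ 3) (Sum.inr ()) (Sum.inr ()) = ∑ i, ∑ j, x i * C i j * x j := by
  rw [hA, pow_succ', pow_two]
  simp [Matrix.fromBlocks_multiply, Matrix.mul_apply, Finset.mul_sum, mul_assoc]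
end

section
/- Let A be a real symmetric n×n matrix with eigenvalues λ₁,…,λₙ (listed with multiplicity), and let m₁,…,mₙ be nonnegative real numbers with |λ_l| ≤ m_l for each l. Then for every natural number k and all indices p, q, the (p,q) entry of the k-th power of A satisfies |(A^k)_{pq}| ≤ Σ_{l=1}^{n} m_l^k. -/
/-- Spectral expansion of an entry of a power of a Hermitian matrix. -/
theorem Matrix.IsHermitian.pow_apply_eq_sum {𝕜 ι : Type*} [RCLike 𝕜] [Fintype ι] [DecidableEq ι]
    {A : Matrix ι ι 𝕜} (hA : A.IsHermitian) (k : ℕ) (p q : ι) :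
    (A ^ k) p q = ∑ l, (hA.eigenvectorUnitary : Matrix ι ι 𝕜) p l *
      (hA.eigenvalues l : 𝕜) ^ k * star ((hA.eigenvectorUnitary : Matrix ι ι 𝕜) q l) := by
  conv_lhs => rw [hA.spectral_theorem, ← map_pow, Unitary.conjStarAlgAut_apply,
    Matrix.diagonal_pow]
  simp [Matrix.mul_apply (M := _ * _), Matrix.mul_diagonal, Matrix.star_apply]

theorem Matrix.IsHermitian.norm_pow_apply_le {𝕜 ι : Type*} [RCLike 𝕜] [Fintype ι] [DecidableEq ι]
    {A : Matrix ι ι 𝕜} (hA : A.IsHermitian) (k : ℕ) (p q : ι) :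
    ‖(A ^ k) p q‖ ≤ ∑ l, |hA.eigenvalues l| ^ k := by
  rw [hA.pow_apply_eq_sum]
  refine norm_sum_le_of_le _ fun l _ => ?_
  have hp := entry_norm_bound_of_unitary hA.eigenvectorUnitary.2 p l
  have hq := entry_norm_bound_of_unitary hA.eigenvectorUnitary.2 q l
  rw [norm_mul, norm_mul, norm_pow, norm_star, RCLike.norm_ofReal]
  exact (mul_le_of_le_one_right (by positivity) hq).trans
    (mul_le_of_le_one_left (by positivity) hp)

/-- Entrywise bound on powers of a real symmetric matrix via bounds on its eigenvalues:
`|(A^k)_{pq}| ≤ Σ_l m_l^k` whenever `|λ_l| ≤ m_l` for each eigenvalue `λ_l`. -/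
theorem abs_entry_pow_le_sum_pow {n : ℕ}
    (A : Matrix (Fin n) (Fin n) ℝ) (hA : A.IsHermitian)
    (m : Fin n → ℝ) (hm0 : ∀ l, 0 ≤ m l)
    (hm : ∀ l, |hA.eigenvalues l| ≤ m l) :
    ∀ (k : ℕ) (p q : Fin n), |(A ^ k) p q| ≤ ∑ l, m l ^ k := by
  intro k p q
  exact (hA.norm_pow_apply_le k p q).trans
    (Finset.sum_le_sum fun l _ => pow_le_pow_left₀ (abs_nonneg _) (hm l) k)
end
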